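/- arXiv:0808.0212 — 3 statements merged into one kernel-verified Lean document; each statement's English description precedes it below -/
import Mathlib

section
/- Let L be a finite-dimensional Lie algebra over a field K of characteristic zero. If H^{dim L − 1}(L, V) = 0 for every finite-dimensional non-trivial irreducible L-module V, then H^1(L, V) = 0 for every finite-dimensional non-trivial irreducible L-module V. -/
/-! Chevalley–Eilenberg cohomology of a Lie algebra, and the predicate
`CE.cohomologyVanishes K L V n` expressing `Hⁿ(L, V) = 0`. -/

namespace CE

variable {K : Type} [CommRing K] {L : Type} [LieRing L] [LieAlgebra K L]
  {V : Type} [AddCommGroup V] [Module K V] [LieRingModule L V] [LieModule K L V]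

/-- The Chevalley–Eilenberg differential of an alternating `n`-cochain, as a raw
function on `(n+1)`-tuples of elements of `L`:
`(d f)(x₀,…,xₙ) = ∑ᵢ (-1)ⁱ xᵢ · f(x₀,…,x̂ᵢ,…,xₙ)
  + ∑_{i<j} (-1)ʲ f(x₀,…,x_{i-1},⁅xᵢ,xⱼ⁆,x_{i+1},…,x̂ⱼ,…,xₙ)`. -/
def d {n : ℕ} (f : L [⋀^Fin n]→ₗ[K] V) (x : Fin (n + 1) → L) : V :=
  (∑ i : Fin (n + 1), ((-1 : K) ^ (i : ℕ)) • ⁅x i, f (x ∘ i.succAbove)⁆) +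
  ∑ j : Fin (n + 1), ∑ i : Fin (n + 1),
    if h : (i : ℕ) < (j : ℕ) then
      ((-1 : K) ^ (j : ℕ)) •
        f (Function.update (x ∘ j.succAbove)
            ⟨(i : ℕ), lt_of_lt_of_le h (Nat.lt_succ_iff.mp j.isLt)⟩ ⁅x i, x j⁆)
    else 0

variable (K L V) in
/-- `Hⁿ(L, V) = 0`, expressed via the Chevalley–Eilenberg complex: in degree `0`
every invariant `0`-cochain is zero (recall `H⁰(L,V) = Vᴸ`), and in degree `n + 1`
every cocycle is a coboundary. -/
def cohomologyVanishes : ℕ → Prop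
  | 0 => ∀ f : L [⋀^Fin 0]→ₗ[K] V, (∀ x, d f x = 0) → f = 0
  | (m + 1) => ∀ f : L [⋀^Fin (m + 1)]→ₗ[K] V,
      (∀ x, d f x = 0) → ∃ g : L [⋀^Fin m]→ₗ[K] V, ∀ x, f x = d g x

end CE

namespace CE

open Fin Function

section Differential

variable {K : Type} [CommRing K] {L : Type} [LieRing L] [LieAlgebra K L]
  {V : Type} [AddCommGroup V] [Module K V] [LieRingModule L V] [LieModule K L V]

theorem sum_update_map_eq_zero_of_eq {M : Type} [AddCommGroup M] [Module K M] {n : ℕ}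
    (f : M [⋀^Fin n]→ₗ[K] V) (A : M → M) {v : Fin n → M} {i j : Fin n}
    (hv : v i = v j) (hij : i ≠ j) :
    ∑ k, f (update v k (A (v k))) = 0 := by
  have hsum : ∑ k, f (update v k (A (v k))) =
      f (update v i (A (v i))) + f (update v j (A (v j))) := by
    refine Fintype.sum_eq_add _ _ hij fun k hk ↦ ?_
    exact f.map_eq_zero_of_eq _ (by simp [update_of_ne hk.1.symm, update_of_ne hk.2.symm, hv]) hij
  have hswap : update v j (A (v j)) = update v i (A (v i)) ∘ Equiv.swap i j := by
    ext k
    rcases eq_or_ne k i with rfl | hki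
    · simp [hij, hij.symm, hv]
    rcases eq_or_ne k j with rfl | hkj
    · simp [hv]
    simp [Equiv.swap_apply_of_ne_of_ne hki hkj, hki, hkj]
  rw [hsum, hswap, f.map_swap _ hij, add_neg_cancel]

/-- The action of `x : L` on alternating cochains by the Lie derivative. -/
def lieDer {n : ℕ} (x : L) (f : L [⋀^Fin n]→ₗ[K] V) : L [⋀^Fin n]→ₗ[K] V where
  toMultilinearMap := (LieModule.toEnd K L V x).compMultilinearMap f.toMultilinearMap -
    ∑ j, f.toMultilinearMap.compLinearMap (update (fun _ ↦ LinearMap.id) j (LieAlgebra.ad K L x))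
  map_eq_zero_of_eq' v i j hv hij := by
    have h := sum_update_map_eq_zero_of_eq f (fun y ↦ ⁅x, y⁆) hv hij
    have key : ∀ k : Fin n, (fun l ↦ (update (fun _ ↦ (LinearMap.id : L →ₗ[K] L)) k
        (LieAlgebra.ad K L x) l) (v l)) = update v k ⁅x, v k⁆ := by
      intro k
      ext l
      rcases eq_or_ne l k with rfl | hl <;> simp [*]
    simp [key, h, f.map_eq_zero_of_eq v hv hij]

theorem lieDer_apply {n : ℕ} (x : L) (f : L [⋀^Fin n]→ₗ[K] V) (v : Fin n → L) :
    lieDer x f v = ⁅x, f v⁆ - ∑ j, f (update v j ⁅x, v j⁆) := by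
  have key : ∀ k : Fin n, (fun l ↦ (update (fun _ ↦ (LinearMap.id : L →ₗ[K] L)) k
      (LieAlgebra.ad K L x) l) (v l)) = update v k ⁅x, v k⁆ := by
    intro k
    ext l
    rcases eq_or_ne l k with rfl | hl <;> simp [*]
  change ⁅x, f v⁆ - (∑ j, f.toMultilinearMap.compLinearMap
    (update (fun _ ↦ LinearMap.id) j (LieAlgebra.ad K L x))) v = _
  simp [key]

theorem lieDer_cons {n : ℕ} (x y : L) (f : L [⋀^Fin (n + 1)]→ₗ[K] V) (z : Fin n → L) :
    lieDer x f (Fin.cons y z) = lieDer x (f.curryLeft y) z - f (Fin.cons ⁅x, y⁆ z) := by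
  simp only [lieDer_apply, Fin.sum_univ_succ, Fin.cons_zero, Fin.cons_succ, Fin.update_cons_zero,
    ← Fin.cons_update, AlternatingMap.curryLeft_apply_apply, Matrix.vecCons]
  abel

omit [LieModule K L V] in
theorem d_zero (f : L [⋀^Fin 0]→ₗ[K] V) (x : Fin 1 → L) (w : Fin 0 → L) :
    d f x = ⁅x 0, f w⁆ := by
  simp [d, Subsingleton.elim _ w]

theorem cons_comp_succAbove_succ {M : Type} {n : ℕ} (x : M) (y : Fin (n + 1) → M)
    (i : Fin (n + 1)) :
    (Fin.cons x y : Fin (n + 2) → M) ∘ i.succ.succAbove = Fin.cons x (y ∘ i.succAbove) := by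
  ext k
  cases k using Fin.cases <;> simp

theorem cons_comp_succAbove_zero {M : Type} {n : ℕ} (x : M) (y : Fin n → M) :
    (Fin.cons x y : Fin (n + 1) → M) ∘ (0 : Fin (n + 1)).succAbove = y := by
  ext k
  simp

theorem d_cons {n : ℕ} (f : L [⋀^Fin (n + 1)]→ₗ[K] V) (x : L) (y : Fin (n + 1) → L) :
    d f (Fin.cons x y) = lieDer x f y - d (f.curryLeft x) y := by
  have h1 : ∀ j : Fin (n + 1), f (update (Fin.cons x (y ∘ j.succAbove)) 0 ⁅x, y j⁆) =
      (-1 : K) ^ (j : ℕ) • f (update y j ⁅x, y j⁆) := by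
    intro j
    rw [Fin.update_cons_zero]
    have := f.map_insertNth j ⁅x, y j⁆ (y ∘ j.succAbove)
    have h2 : j.insertNth ⁅x, y j⁆ (y ∘ j.succAbove) = update y j ⁅x, y j⁆ := by
      rw [← Fin.insertNth_removeNth]; rfl
    rw [h2] at this
    rw [this, ← Int.cast_smul_eq_zsmul K, smul_smul]
    simp [← mul_pow, Matrix.vecCons]
  have h3 : ∀ j : Fin (n + 1), (-1 : K) ^ ((j : ℕ) + 1) • (-1 : K) ^ (j : ℕ) •
      f (update y j ⁅x, y j⁆) = - f (update y j ⁅x, y j⁆) := by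
    intro j
    rw [smul_smul, pow_succ, mul_right_comm, ← mul_pow]
    simp
  have h4 : ∀ (j i : Fin (n + 1)) (h : (i : ℕ) < j) (h' : (i : ℕ) + 1 < n + 1),
      f (update (Fin.cons x (y ∘ j.succAbove)) ⟨(i : ℕ) + 1, h'⟩ ⁅y i, y j⁆) =
      f.curryLeft x (update (y ∘ j.succAbove) ⟨i, by omega⟩ ⁅y i, y j⁆) := by
    intro j i h h'
    rw [AlternatingMap.curryLeft_apply_apply, Matrix.vecCons, Fin.cons_update]
    rfl
  rw [d, Fin.sum_univ_succ, Fin.sum_univ_succ (n := n + 1)]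
  simp only [Fin.sum_univ_succ (n := n + 1)]
  simp only [Fin.val_succ, Fin.val_zero, Nat.zero_lt_succ, dite_true, cons_comp_succAbove_succ,
    cons_comp_succAbove_zero, Fin.cons_zero, Fin.cons_succ, add_lt_add_iff_right, pow_zero, one_smul,
    Fin.mk_zero, h1, h3, Finset.sum_add_distrib, Finset.sum_neg_distrib]
  rw [lieDer_apply, d]
  have h5 : (∑ j : Fin (n + 1), ∑ i : Fin (n + 1), if h : (i : ℕ) < j then
      (-1 : K) ^ ((j : ℕ) + 1) • f (update (Fin.cons x (y ∘ j.succAbove))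
        ⟨(i : ℕ) + 1, by omega⟩ ⁅y i, y j⁆) else 0) =
      -∑ j : Fin (n + 1), ∑ i : Fin (n + 1), if h : (i : ℕ) < j then
      (-1 : K) ^ (j : ℕ) • f.curryLeft x (update (y ∘ j.succAbove)
        ⟨i, by omega⟩ ⁅y i, y j⁆) else 0 := by
    simp only [← Finset.sum_neg_distrib]
    refine Finset.sum_congr rfl fun j _ ↦ Finset.sum_congr rfl fun i _ ↦ ?_
    split_ifs with h
    · rw [h4 j i h, pow_succ, mul_neg_one, neg_smul]
    · simp
  have h6 : ∑ i : Fin (n + 1), (-1 : K) ^ ((i : ℕ) + 1) •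
      ⁅y i, f (Fin.cons x (y ∘ i.succAbove))⁆ =
      -∑ i : Fin (n + 1), (-1 : K) ^ (i : ℕ) • ⁅y i, f.curryLeft x (y ∘ i.succAbove)⁆ := by
    simp only [← Finset.sum_neg_distrib]
    refine Finset.sum_congr rfl fun i _ ↦ ?_
    rw [pow_succ, mul_neg_one, neg_smul]
    rfl
  rw [h5, h6]
  simp only [Nat.not_lt_zero, dite_false, Finset.sum_const_zero]
  abel

omit [LieModule K L V] in
theorem d_add {n : ℕ} (f g : L [⋀^Fin n]→ₗ[K] V) (x : Fin (n + 1) → L) :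
    d (f + g) x = d f x + d g x := by
  simp only [d, AlternatingMap.add_apply, lie_add, smul_add, Finset.sum_add_distrib]
  rw [add_add_add_comm, ← Finset.sum_add_distrib]
  simp only [← Finset.sum_add_distrib]
  congr! 5
  split_ifs <;> simp

theorem d_smul {n : ℕ} (c : K) (f : L [⋀^Fin n]→ₗ[K] V) (x : Fin (n + 1) → L) :
    d (c • f) x = c • d f x := by
  simp only [d, AlternatingMap.smul_apply, lie_smul, smul_add, Finset.smul_sum, smul_dite,
    smul_zero, smul_comm c]

theorem exists_alternatingMap_eq_d : ∀ {n : ℕ} (f : L [⋀^Fin n]→ₗ[K] V),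
    ∃ F : L [⋀^Fin (n + 1)]→ₗ[K] V, ∀ x, F x = d f x
  | 0, f => by
    refine ⟨(AlternatingMap.ofSubsingleton (ι := Fin 1) K L V 0)
      { toFun := fun x ↦ ⁅x, f default⁆
        map_add' := by simp
        map_smul' := by simp }, fun x ↦ ?_⟩
    rw [d_zero f x default]
    rfl
  | n + 1, f => by
    choose D hD using fun g : L [⋀^Fin n]→ₗ[K] V ↦ exists_alternatingMap_eq_d g
    let A : L →ₗ[K] L [⋀^Fin (n + 1)]→ₗ[K] V :=
      { toFun := fun x ↦ lieDer x f - D (f.curryLeft x)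
        map_add' := fun x y ↦ by
          ext v
          simp only [AlternatingMap.sub_apply, AlternatingMap.add_apply, hD, lieDer_apply, map_add,
            d_add, add_lie, AlternatingMap.map_update_add, Finset.sum_add_distrib]
          abel
        map_smul' := fun c x ↦ by
          ext v
          simp only [AlternatingMap.sub_apply, AlternatingMap.smul_apply, hD, lieDer_apply,
            map_smul, d_smul, smul_lie, AlternatingMap.map_update_smul, smul_sub, Finset.smul_sum,
            RingHom.id_apply] }
    have hA : ∀ x v, A x v = d f (Fin.cons x v) := fun x v ↦ by
      rw [d_cons, ← hD]
      rfl
    have hA₂ : ∀ x z, A x (Fin.cons x z) = 0 := fun x z ↦ by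
      change lieDer x f _ - D (f.curryLeft x) _ = 0
      rw [lieDer_cons, lie_self, hD]
      cases n with
      | zero =>
        rw [d_zero _ _ z, Fin.cons_zero, lieDer_apply]
        have : f (Fin.cons 0 z) = 0 := f.map_coord_zero 0 (by simp)
        simp [this]
      | succ n =>
        have : f (Fin.cons 0 z) = 0 := f.map_coord_zero 0 (by simp)
        have h0 : d (0 : L [⋀^Fin n]→ₗ[K] V) z = 0 := by
          simpa using d_smul (0 : K) (0 : L [⋀^Fin n]→ₗ[K] V) z
        rw [d_cons, AlternatingMap.curryLeft_same, h0, this]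
        abel
    have hA₃ : ∀ x v j, v j = x → A x v = 0 := fun x v j hj ↦ by
      have h := (A x).map_insertNth j x (j.removeNth v)
      have h' : j.insertNth x (j.removeNth v) = v := by
        rw [← hj, Fin.insertNth_self_removeNth]
      rw [h', Matrix.vecCons, hA₂, smul_zero] at h
      exact h
    refine ⟨{ toMultilinearMap := LinearMap.uncurryLeft (AlternatingMap.toMultilinearMapLM ∘ₗ A)
              map_eq_zero_of_eq' := fun v i j hv hij ↦ ?_ }, fun x ↦ ?_⟩
    · change A (v 0) (Fin.tail v) = 0
      cases i using Fin.cases with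
      | zero =>
        cases j using Fin.cases with
        | zero => exact absurd rfl hij
        | succ j => exact hA₃ _ _ j hv.symm
      | succ i =>
        cases j using Fin.cases with
        | zero => exact hA₃ _ _ i hv
        | succ j => exact (A (v 0)).map_eq_zero_of_eq _ hv (by simpa using hij)
    · change A (x 0) (Fin.tail x) = _
      rw [hA, Fin.cons_self_tail]

/-- The Chevalley–Eilenberg differential as a map between spaces of alternating cochains. -/
noncomputable def differential {n : ℕ} (f : L [⋀^Fin n]→ₗ[K] V) : L [⋀^Fin (n + 1)]→ₗ[K] V :=
  (exists_alternatingMap_eq_d f).choose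

theorem differential_apply {n : ℕ} (f : L [⋀^Fin n]→ₗ[K] V) (x : Fin (n + 1) → L) :
    differential f x = d f x :=
  (exists_alternatingMap_eq_d f).choose_spec x

end Differential

end CE

namespace CE

open Fin Function

section Wedge

variable {K : Type} [CommRing K] {L : Type} [LieRing L] [LieAlgebra K L]
  {V : Type} [AddCommGroup V] [Module K V] [LieRingModule L V] [LieModule K L V]
  {U : Type} [AddCommGroup U] [Module K U] [LieRingModule L U] [LieModule K L U]

/-- The wedge product of a `1`-cochain valued in `Hom(V, U)` with an `n`-cochain valued in `V`. -/
def wedge {n : ℕ} (f : L →ₗ[K] V →ₗ[K] U) (g : L [⋀^Fin n]→ₗ[K] V) : L [⋀^Fin (n + 1)]→ₗ[K] U :=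
  AlternatingMap.alternatizeUncurryFin
    { toFun := fun x ↦ (f x).compAlternatingMap g
      map_add' := fun x y ↦ by ext; simp
      map_smul' := fun c x ↦ by ext; simp }

omit [LieRingModule L V] [LieModule K L V] [LieRingModule L U] [LieModule K L U] in
theorem wedge_apply {n : ℕ} (f : L →ₗ[K] V →ₗ[K] U) (g : L [⋀^Fin n]→ₗ[K] V)
    (x : Fin (n + 1) → L) :
    wedge f g x = ∑ k : Fin (n + 1), (-1 : K) ^ (k : ℕ) • f (x k) (g (x ∘ k.succAbove)) := by
  rw [wedge, AlternatingMap.alternatizeUncurryFin_apply]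
  refine Finset.sum_congr rfl fun k _ ↦ ?_
  rw [← Int.cast_smul_eq_zsmul K]
  simp
  rfl

omit [LieRingModule L V] [LieModule K L V] [LieRingModule L U] [LieModule K L U] in
theorem curryLeft_wedge {n : ℕ} (f : L →ₗ[K] V →ₗ[K] U) (g : L [⋀^Fin (n + 1)]→ₗ[K] V) (x : L) :
    (wedge f g).curryLeft x = (f x).compAlternatingMap g - wedge f (g.curryLeft x) := by
  ext y
  have h (k : Fin (n + 1)) : (Fin.cons x y : Fin (n + 2) → L) ∘ k.succ.succAbove =
      Fin.cons x (y ∘ k.succAbove) := cons_comp_succAbove_succ x y k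
  simp only [AlternatingMap.curryLeft_apply_apply, Matrix.vecCons, wedge_apply,
    AlternatingMap.sub_apply, Fin.sum_univ_succ (n := n + 1), cons_comp_succAbove_zero, h,
    Fin.cons_zero, Fin.cons_succ, Fin.val_zero, pow_zero, one_smul, Fin.val_succ, pow_succ,
    mul_neg_one, neg_smul, Finset.sum_neg_distrib, LinearMap.compAlternatingMap_apply]
  abel

theorem lieDer_wedge {n : ℕ} (f : L →ₗ[K] V →ₗ[K] U) (g : L [⋀^Fin n]→ₗ[K] V) (x : L)
    (y : Fin (n + 1) → L) :
    lieDer x (wedge f g) y = wedge f (lieDer x g) y +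
      ∑ k : Fin (n + 1), (-1 : K) ^ (k : ℕ) • (⁅x, f (y k) (g (y ∘ k.succAbove))⁆ -
        f (y k) ⁅x, g (y ∘ k.succAbove)⁆ - f ⁅x, y k⁆ (g (y ∘ k.succAbove))) := by
  have hupd (k : Fin (n + 1)) (i : Fin n) :
      update y (k.succAbove i) ⁅x, y (k.succAbove i)⁆ ∘ k.succAbove =
        update (y ∘ k.succAbove) i ⁅x, y (k.succAbove i)⁆ :=
    update_comp_eq_of_injective _ k.succAbove_right_injective _ _
  have hupd₀ (k : Fin (n + 1)) : update y k ⁅x, y k⁆ ∘ k.succAbove = y ∘ k.succAbove :=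
    update_comp_eq_of_notMem_range _ _ (by simp)
  rw [lieDer_apply]
  simp only [wedge_apply]
  rw [Finset.sum_comm, lie_sum, ← Finset.sum_sub_distrib, ← Finset.sum_add_distrib]
  refine Finset.sum_congr rfl fun k _ ↦ ?_
  rw [Fin.sum_univ_succAbove _ k]
  simp only [hupd, hupd₀, update_self, ne_eq, Fin.ne_succAbove, not_false_eq_true, update_of_ne,
    lieDer_apply, map_sub, map_sum, lie_smul, smul_sub, Finset.smul_sum, comp_apply]
  abel

omit [LieModule K L V] [LieModule K L U] in
theorem d_compAlternatingMap {n : ℕ} (φ : V →ₗ[K] U) (g : L [⋀^Fin n]→ₗ[K] V)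
    (y : Fin (n + 1) → L) :
    d (φ.compAlternatingMap g) y = φ (d g y) +
      ∑ k : Fin (n + 1), (-1 : K) ^ (k : ℕ) • (⁅y k, φ (g (y ∘ k.succAbove))⁆ -
        φ ⁅y k, g (y ∘ k.succAbove)⁆) := by
  simp only [d, map_add, map_sum, map_smul, smul_sub, Finset.sum_sub_distrib,
    LinearMap.compAlternatingMap_apply, apply_dite φ, map_zero]
  abel

omit [LieRingModule L V] [LieModule K L V] [LieRingModule L U] [LieModule K L U] in
theorem curryLeft_wedge_zero (f : L →ₗ[K] V →ₗ[K] U) (g : L [⋀^Fin 0]→ₗ[K] V) (x : L) :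
    (wedge f g).curryLeft x = (f x).compAlternatingMap g := by
  ext y
  simp [wedge_apply, Matrix.vecCons]

omit [LieRingModule L V] [LieModule K L V] [LieRingModule L U] [LieModule K L U] in
theorem wedge_sub {n : ℕ} (f : L →ₗ[K] V →ₗ[K] U) (g h : L [⋀^Fin n]→ₗ[K] V) :
    wedge f (g - h) = wedge f g - wedge f h := by
  ext y
  simp [wedge_apply, smul_sub]

theorem curryLeft_differential {n : ℕ} (g : L [⋀^Fin (n + 1)]→ₗ[K] V) (x : L) :
    (differential g).curryLeft x = lieDer x g - differential (g.curryLeft x) := by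
  ext y
  rw [AlternatingMap.curryLeft_apply_apply, Matrix.vecCons, differential_apply, d_cons,
    AlternatingMap.sub_apply, differential_apply]

theorem curryLeft_differential_zero (g : L [⋀^Fin 0]→ₗ[K] V) (x : L) :
    (differential g).curryLeft x = lieDer x g := by
  ext y
  rw [AlternatingMap.curryLeft_apply_apply, Matrix.vecCons, differential_apply, d_zero g _ y,
    lieDer_apply]
  simp

/-- The Leibniz rule for a closed `1`-cochain `f`. -/
theorem d_wedge (f : L →ₗ[K] V →ₗ[K] U)
    (hf : ∀ x y v, f ⁅x, y⁆ v = ⁅x, f y v⁆ - f y ⁅x, v⁆ - (⁅y, f x v⁆ - f x ⁅y, v⁆)) :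
    ∀ {n : ℕ} (g : L [⋀^Fin n]→ₗ[K] V) (x : Fin (n + 2) → L),
      d (wedge f g) x = - wedge f (differential g) x := by
  have hlie : ∀ {n : ℕ} (g : L [⋀^Fin n]→ₗ[K] V) (x : L) (y : Fin (n + 1) → L),
      lieDer x (wedge f g) y =
        wedge f (lieDer x g) y + d ((f x).compAlternatingMap g) y - f x (d g y) := by
    intro n g x y
    rw [lieDer_wedge, d_compAlternatingMap]
    simp only [hf, sub_sub_cancel]
    abel
  have hcons : ∀ {n : ℕ} (g : L [⋀^Fin n]→ₗ[K] V) (x : L) (y : Fin (n + 1) → L),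
      wedge f (differential g) (Fin.cons x y) =
        f x (d g y) - wedge f ((differential g).curryLeft x) y := by
    intro n g x y
    rw [← differential_apply]
    exact DFunLike.congr_fun (curryLeft_wedge f (differential g) x) y
  intro n
  induction n with
  | zero =>
    intro g x
    obtain ⟨x, y, rfl⟩ : ∃ a b, x = Fin.cons a b := ⟨_, _, (Fin.cons_self_tail x).symm⟩
    rw [d_cons, hlie, hcons, curryLeft_wedge_zero, curryLeft_differential_zero]
    abel
  | succ n ih =>
    intro g x
    obtain ⟨x, y, rfl⟩ : ∃ (a : L) (b : Fin (n + 2) → L), x = Fin.cons a b :=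
      ⟨_, _, (Fin.cons_self_tail x).symm⟩
    rw [d_cons, hlie, hcons, curryLeft_wedge, curryLeft_differential, wedge_sub,
      ← differential_apply (_ - _)]
    have hsub : differential ((f x).compAlternatingMap g - wedge f (g.curryLeft x)) y =
        d ((f x).compAlternatingMap g) y + wedge f (differential (g.curryLeft x)) y := by
      rw [differential_apply, sub_eq_add_neg, d_add, ← neg_one_smul K (wedge f _), d_smul, ih]
      simp
    rw [hsub, AlternatingMap.sub_apply]
    abel

end Wedge

end CE

namespace CE

open Fin Function

section Duality

variable {K : Type} [Field K] {L : Type} [LieRing L] [LieAlgebra K L]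
  {V : Type} [AddCommGroup V] [Module K V] [LieRingModule L V] [LieModule K L V]
  {U : Type} [AddCommGroup U] [Module K U] [LieRingModule L U] [LieModule K L U] {m : ℕ}

omit [LieAlgebra K L] [LieRingModule L V] [LieModule K L V] in
theorem map_update_basis [Module K L] (e : Module.Basis (Fin m) K L) (ω : L [⋀^Fin m]→ₗ[K] V)
    (i : Fin m) (z : L) : ω (update e i z) = e.repr z i • ω e := by
  conv_lhs => rw [← e.sum_repr z]
  rw [← AlternatingMap.coe_multilinearMap, MultilinearMap.map_update_sum]
  rw [Finset.sum_eq_single i]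
  · simp
  · intro k _ hk
    rw [MultilinearMap.map_update_smul, AlternatingMap.coe_multilinearMap,
      ω.map_update_self e hk.symm, smul_zero]
  · simp

omit [LieAlgebra K L] [LieRingModule L V] [LieModule K L V] in
theorem eq_zero_of_map_basis_eq_zero [Module K L] (e : Module.Basis (Fin m) K L)
    {ω : L [⋀^Fin m]→ₗ[K] V} (h : ω e = 0) : ω = 0 := by
  refine e.ext_alternating fun v hv ↦ ?_
  have := ω.map_perm e (Equiv.ofBijective v (Finite.injective_iff_bijective.mp hv))
  rw [h, smul_zero] at this
  exact this

omit [LieRingModule L V] [LieModule K L V] in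
theorem smul_map_update_comp_succAbove (e : Module.Basis (Fin (m + 1)) K L)
    (c : L [⋀^Fin m]→ₗ[K] V) {i j : Fin (m + 1)} (hij : i ≠ j) (z : L) :
    (-1 : K) ^ (j : ℕ) • c (update e i z ∘ j.succAbove) =
      e.repr z i • (-1 : K) ^ (j : ℕ) • c (e ∘ j.succAbove) -
        e.repr z j • (-1 : K) ^ (i : ℕ) • c (e ∘ i.succAbove) := by
  have h := map_update_basis e
    (wedge ((e.coord j).smulRight (LinearMap.id : V →ₗ[K] V)) c) i z
  rw [wedge_apply, wedge_apply, Fintype.sum_eq_add i j hij, Finset.sum_eq_single j] at h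
  · have hi : update e i z ∘ i.succAbove = e ∘ i.succAbove :=
      update_comp_eq_of_notMem_range _ _ (by simp)
    simp [hij.symm, hi] at h
    rw [← h, smul_comm]
    abel
  · intro k _ hk
    simp [hk.symm]
  · simp
  · intro k hk
    simp [hk.1, hk.2]

omit [LieModule K L V] in
theorem d_basis (e : Module.Basis (Fin (m + 1)) K L) (c : L [⋀^Fin m]→ₗ[K] V) :
    d c e = ∑ j : Fin (m + 1), (-1 : K) ^ (j : ℕ) • (⁅e j, c (e ∘ j.succAbove)⁆ -
      LinearMap.trace K L (LieAlgebra.ad K L (e j)) • c (e ∘ j.succAbove)) := by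
  have htr : ∀ x, LinearMap.trace K L (LieAlgebra.ad K L x) = ∑ i, e.repr ⁅x, e i⁆ i := by
    intro x
    simp [LinearMap.trace_eq_matrix_trace K e, Matrix.trace, LinearMap.toMatrix_apply]
  set a : Fin (m + 1) → V := fun j ↦ (-1 : K) ^ (j : ℕ) • c (e ∘ j.succAbove) with ha
  have hterm : ∀ j i : Fin (m + 1), (if h : (i : ℕ) < (j : ℕ) then
      ((-1 : K) ^ (j : ℕ)) • c (Function.update (e ∘ j.succAbove)
        ⟨(i : ℕ), lt_of_lt_of_le h (Nat.lt_succ_iff.mp j.isLt)⟩ ⁅e i, e j⁆) else 0) =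
      (if i < j then e.repr ⁅e i, e j⁆ i • a j else 0) -
        (if i < j then e.repr ⁅e i, e j⁆ j • a i else 0) := by
    intro j i
    by_cases h : i < j
    · rw [dif_pos (Fin.lt_def.mp h), if_pos h, if_pos h, ← smul_map_update_comp_succAbove e c h.ne]
      congr 2
      have hi : j.succAbove ⟨i, by omega⟩ = i := by
        rw [Fin.succAbove_of_castSucc_lt _ _ h]
        rfl
      conv_rhs => rw [← hi]
      rw [update_comp_eq_of_injective _ j.succAbove_right_injective]
      simp [hi]
    · rw [dif_neg (mt Fin.lt_def.mpr h), if_neg h, if_neg h, sub_zero]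
  have hsum : ∑ j : Fin (m + 1), ∑ i : Fin (m + 1),
      ((if i < j then e.repr ⁅e i, e j⁆ i • a j else 0) -
        (if i < j then e.repr ⁅e i, e j⁆ j • a i else 0)) =
      - ∑ j, LinearMap.trace K L (LieAlgebra.ad K L (e j)) • a j := by
    simp only [Finset.sum_sub_distrib]
    rw [Finset.sum_comm (f := fun j i ↦ if i < j then e.repr ⁅e i, e j⁆ j • a i else 0)]
    simp only [← Finset.sum_sub_distrib, ← Finset.sum_neg_distrib, htr, Finset.sum_smul]
    refine Finset.sum_congr rfl fun j _ ↦ Finset.sum_congr rfl fun i _ ↦ ?_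
    have hskew : e.repr ⁅e i, e j⁆ i = -e.repr ⁅e j, e i⁆ i := by
      rw [← lie_skew, map_neg, Finsupp.neg_apply]
    rcases lt_trichotomy i j with h | rfl | h
    · simp [h, h.not_gt, hskew]
    · simp
    · simp [h, h.not_gt]
  rw [d]
  simp only [hterm]
  rw [hsum, ← sub_eq_add_neg, ← Finset.sum_sub_distrib]
  refine Finset.sum_congr rfl fun j _ ↦ ?_
  rw [smul_sub, smul_comm]

omit [LieRingModule L V] [LieModule K L V] in
theorem exists_cochain_basis (e : Module.Basis (Fin (m + 1)) K L) (v : Fin (m + 1) → V) :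
    ∃ c : L [⋀^Fin m]→ₗ[K] V, ∀ i : Fin (m + 1), (-1 : K) ^ (i : ℕ) • c (e ∘ i.succAbove) = v i := by
  refine ⟨∑ k, (LinearMap.toSpanSingleton K V (v k)).compAlternatingMap (e.det.curryLeft (e k)),
    fun i ↦ ?_⟩
  have h : ∀ k, (-1 : K) ^ (i : ℕ) • e.det (Matrix.vecCons (e k) (e ∘ i.succAbove)) =
      e.repr (e k) i := by
    intro k
    have h1 := e.det.neg_one_pow_smul_map_insertNth i (e k) (e ∘ i.succAbove)
    have h2 : i.insertNth (e k) (e ∘ i.succAbove) = update e i (e k) := by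
      rw [← Fin.insertNth_removeNth]; rfl
    rw [h2, map_update_basis, e.det_self, ← Int.cast_smul_eq_zsmul K] at h1
    rw [← h1, smul_smul]
    simp [← mul_pow]
  have hs : ∀ (g : Fin (m + 1) → L [⋀^Fin m]→ₗ[K] V) (w : Fin m → L),
      (∑ k, g k) w = ∑ k, g k w := fun g w ↦
    map_sum ({ toFun := fun a ↦ a w, map_zero' := rfl, map_add' := fun _ _ ↦ rfl } :
      (L [⋀^Fin m]→ₗ[K] V) →+ V) g _
  simp only [hs, LinearMap.compAlternatingMap_apply, Finset.smul_sum,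
    AlternatingMap.curryLeft_apply_apply, LinearMap.toSpanSingleton_apply]
  simp only [← smul_assoc, h]
  simp [Finsupp.single_apply]

theorem sum_map_basis_eq_zero (e : Module.Basis (Fin (m + 1)) K L)
    (hV : cohomologyVanishes K L V m)
    (hU : ∀ (x : L) (u : U), ⁅x, u⁆ = LinearMap.trace K L (LieAlgebra.ad K L x) • u)
    (f : L →ₗ[K] V →ₗ[K] U)
    (hf : ∀ x y v, f ⁅x, y⁆ v = ⁅x, f y v⁆ - f y ⁅x, v⁆ - (⁅y, f x v⁆ - f x ⁅y, v⁆))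
    (v : Fin (m + 1) → V)
    (hv : ∑ i, (⁅e i, v i⁆ - LinearMap.trace K L (LieAlgebra.ad K L (e i)) • v i) = 0) :
    ∑ i, f (e i) (v i) = 0 := by
  obtain ⟨c, hc⟩ := exists_cochain_basis e v
  have hdc : differential c = 0 := by
    apply eq_zero_of_map_basis_eq_zero e
    rw [differential_apply, d_basis, ← hv]
    refine Finset.sum_congr rfl fun i _ ↦ ?_
    rw [← hc, lie_smul, smul_sub, smul_comm (LinearMap.trace K L _)]
  have hdc' : ∀ x, d c x = 0 := fun x ↦ by rw [← differential_apply, hdc]; rfl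
  have hw : wedge f c e = ∑ i, f (e i) (v i) := by
    rw [wedge_apply]
    exact Finset.sum_congr rfl fun i _ ↦ by rw [← hc, map_smul]
  rw [← hw]
  cases m with
  | zero =>
    rw [hV c hdc', wedge_apply]
    simp
  | succ m =>
    obtain ⟨g, hg⟩ := hV c hdc'
    obtain rfl : c = differential g := by
      ext x
      rw [hg, differential_apply]
    rw [← neg_eq_zero, ← d_wedge f hf, d_basis]
    simp [hU]

end Duality

end CE

namespace CE

open Fin Function

section Modules

attribute [local instance] LieRing.ofAssociativeRing LieAlgebra.ofAssociativeAlgebra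

variable (K : Type) [Field K] (L : Type) [LieRing L] [LieAlgebra K L]

/-- The one-dimensional `L`-module on which `x` acts by the scalar `tr (ad x)`. -/
def ModularLine (K _L : Type) : Type := K

instance : AddCommGroup (ModularLine K L) := inferInstanceAs (AddCommGroup K)

instance : Module K (ModularLine K L) := inferInstanceAs (Module K K)

instance : FiniteDimensional K (ModularLine K L) := inferInstanceAs (FiniteDimensional K K)

theorem trace_ad_lie (x y : L) : LinearMap.trace K L (LieAlgebra.ad K L ⁅x, y⁆) = 0 := by
  rw [LieHom.map_lie, LinearMap.trace_lie]

noncomputable instance : LieRingModule L (ModularLine K L) where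
  bracket x u := LinearMap.trace K L (LieAlgebra.ad K L x) • u
  add_lie x y u := by
    rw [map_add, map_add, add_smul]
  lie_add x u v := smul_add _ u v
  leibniz_lie x y u := by
    change _ • _ • u = LinearMap.trace K L (LieAlgebra.ad K L ⁅x, y⁆) • u + _ • _ • u
    rw [trace_ad_lie, zero_smul, zero_add, smul_comm]

instance : LieModule K L (ModularLine K L) where
  smul_lie c x u := by
    change LinearMap.trace K L (LieAlgebra.ad K L (c • x)) • u = c • _ • u
    rw [map_smul, map_smul, smul_assoc]
  lie_smul c x u := smul_comm _ c u

variable {K L}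

theorem ModularLine.lie_def (x : L) (u : ModularLine K L) :
    ⁅x, u⁆ = LinearMap.trace K L (LieAlgebra.ad K L x) • u := rfl

variable (K L) in
theorem ModularLine.isIrreducible : LieModule.IsIrreducible K L (ModularLine K L) := by
  have : Nontrivial (ModularLine K L) := inferInstanceAs (Nontrivial K)
  refine LieModule.IsIrreducible.mk fun N hN ↦ ?_
  have h : (N : Submodule K (ModularLine K L)) ≠ ⊥ := by simpa using hN
  have : IsSimpleOrder (Submodule K (ModularLine K L)) :=
    inferInstanceAs (IsSimpleOrder (Ideal K))
  simpa using (eq_bot_or_eq_top (N : Submodule K (ModularLine K L))).resolve_left h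

variable {W : Type} [AddCommGroup W] [Module K W] [LieRingModule L W] [LieModule K L W]

theorem isIrreducible_dual [FiniteDimensional K W] (hW : LieModule.IsIrreducible K L W) :
    LieModule.IsIrreducible K L (Module.Dual K W) := by
  have : Nontrivial W := LieModule.nontrivial_of_isIrreducible K L W
  refine LieModule.IsIrreducible.mk fun N hN ↦ ?_
  let M : LieSubmodule K L W :=
    { (N : Submodule K (Module.Dual K W)).dualCoannihilator with
      lie_mem := by
        intro x w hw
        change w ∈ (N : Submodule K (Module.Dual K W)).dualCoannihilator at hw
        change ⁅x, w⁆ ∈ (N : Submodule K (Module.Dual K W)).dualCoannihilator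
        rw [Submodule.mem_dualCoannihilator] at hw ⊢
        intro φ hφ
        have := hw ⁅x, φ⁆ (N.lie_mem hφ)
        simpa using this }
  have hM : (M : Submodule K W) = (N : Submodule K (Module.Dual K W)).dualCoannihilator := rfl
  have hNM : (N : Submodule K (Module.Dual K W)) = (M : Submodule K W).dualAnnihilator := by
    rw [hM, Subspace.dualCoannihilator_dualAnnihilator_eq]
  rcases eq_bot_or_eq_top M with h | h
  · rw [h] at hNM
    simpa using hNM
  · rw [h] at hNM
    exact absurd (by simpa using hNM) hN

theorem not_isTrivial_dual (hW : ¬ LieModule.IsTrivial L W) :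
    ¬ LieModule.IsTrivial L (Module.Dual K W) := by
  intro h
  refine hW ⟨fun x w ↦ ?_⟩
  rw [← Module.forall_dual_apply_eq_zero_iff K]
  intro φ
  have := DFunLike.congr_fun (h.trivial x φ) w
  simpa using this

theorem trace_ad_eq_zero {m : ℕ} (e : Module.Basis (Fin (m + 1)) K L)
    (h : ¬ LieModule.IsTrivial L (ModularLine K L) →
      cohomologyVanishes K L (ModularLine K L) m) (x : L) :
    LinearMap.trace K L (LieAlgebra.ad K L x) = 0 := by
  by_cases ht : LieModule.IsTrivial L (ModularLine K L)
  · exact (mul_one _).symm.trans (ht.trivial x (1 : K) :)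
  let f : L →ₗ[K] ModularLine K L →ₗ[K] ModularLine K L :=
    (LinearMap.trace K L ∘ₗ (LieAlgebra.ad K L).toLinearMap).smulRight LinearMap.id
  have hf : ∀ x u, f x u = LinearMap.trace K L (LieAlgebra.ad K L x) • u := fun _ _ ↦ rfl
  have key : f = 0 := by
    refine e.ext fun i ↦ LinearMap.ext fun u ↦ ?_
    have := sum_map_basis_eq_zero e (h ht) ModularLine.lie_def f
      (fun x y v ↦ by
        simp only [hf, trace_ad_lie, zero_smul, ModularLine.lie_def]
        rw [smul_comm (LinearMap.trace K L (LieAlgebra.ad K L x)), sub_self])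
      (Pi.single i u) (by simp [ModularLine.lie_def])
    rw [Finset.sum_eq_single i] at this
    · simpa using this
    · intro k _ hk
      simp [hk]
    · simp
  have := hf x (1 : K)
  rw [key] at this
  exact ((mul_one _).symm.trans this.symm)

theorem cohomologyVanishes_one_of_dual {m : ℕ} (e : Module.Basis (Fin (m + 1)) K L)
    (htr : ∀ x : L, LinearMap.trace K L (LieAlgebra.ad K L x) = 0)
    (h : cohomologyVanishes K L (Module.Dual K W) m) :
    cohomologyVanishes K L W 1 := by
  intro f hf
  let F : L →ₗ[K] W := (AlternatingMap.ofSubsingleton (ι := Fin 1) K L W 0).symm f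
  have hF : ∀ x : Fin 1 → L, f x = F (x 0) := by
    intro x
    change f x = f _
    congr 1
    ext i
    rw [Subsingleton.elim i 0]
  have hcocycle : ∀ x y, F ⁅x, y⁆ = ⁅x, F y⁆ - ⁅y, F x⁆ := by
    intro x y
    have := hf (Fin.cons x fun _ ↦ y)
    rw [d_cons, lieDer_apply, d_zero _ _ default, AlternatingMap.curryLeft_apply_apply, hF, hF,
      Fin.sum_univ_one, hF, update_self] at this
    change ⁅x, F y⁆ - F ⁅x, y⁆ - ⁅y, F x⁆ = 0 at this
    rw [← sub_eq_zero, ← neg_eq_zero, ← this]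
    abel
  let T : W →ₗ[K] (Fin (m + 1) → W) := LinearMap.pi fun i ↦ LieModule.toEnd K L W (e i)
  have hT : (fun i ↦ F (e i)) ∈ LinearMap.range T := by
    by_contra hn
    obtain ⟨φ, hφ, hker⟩ := Submodule.exists_le_ker_of_notMem hn
    apply hφ
    let v : Fin (m + 1) → Module.Dual K W := fun i ↦ φ ∘ₗ LinearMap.single K (fun _ ↦ W) i
    have hv : ∀ w : Fin (m + 1) → W, φ w = ∑ i, v i (w i) := by
      intro w
      conv_lhs => rw [← Finset.univ_sum_single w]
      simp [v]
    let G : L →ₗ[K] Module.Dual K W →ₗ[K] ModularLine K L :=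
      (Module.Dual.eval K W) ∘ₗ F
    have hG : ∀ x (ψ : Module.Dual K W), G x ψ = (ψ (F x) : K) := fun _ _ ↦ rfl
    rw [hv]
    refine sum_map_basis_eq_zero e h ModularLine.lie_def G ?_ v ?_
    · intro x y ψ
      rw [ModularLine.lie_def, ModularLine.lie_def, htr, htr, zero_smul, zero_smul]
      simp only [hG, hcocycle, Module.Dual.lie_apply]
      change ψ _ = 0 - (- ψ _) - (0 - (- ψ _))
      rw [map_sub]
      ring
    · simp only [htr, zero_smul, sub_zero]
      ext w
      have := hker ⟨w, rfl⟩
      rw [LinearMap.mem_ker, hv] at this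
      simpa [T] using this
  obtain ⟨w, hw⟩ := hT
  have hFw : ∀ x, F x = ⁅x, w⁆ := by
    have : F = (LieModule.toEnd K L W).toLinearMap.flip w := e.ext fun i ↦ (congrFun hw i).symm
    intro x
    rw [this]
    rfl
  refine ⟨AlternatingMap.constOfIsEmpty K L (Fin 0) w, fun x ↦ ?_⟩
  rw [hF, hFw, d_zero _ _ default]
  rfl

end Modules

end CE

/-- If `H^{dim L − 1}(L, V) = 0` for every finite-dimensional
non-trivial irreducible `L`-module `V`, then `H¹(L, V) = 0` for every such module. -/
theorem h1_vanishes_of_top_vanishes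
    (K : Type) [Field K] [CharZero K]
    (L : Type) [LieRing L] [LieAlgebra K L] [FiniteDimensional K L]
    (htop : ∀ (V : Type) [AddCommGroup V] [Module K V] [LieRingModule L V]
      [LieModule K L V] [FiniteDimensional K V],
      LieModule.IsIrreducible K L V → ¬ LieModule.IsTrivial L V →
      CE.cohomologyVanishes K L V (Module.finrank K L - 1)) :
    ∀ (V : Type) [AddCommGroup V] [Module K V] [LieRingModule L V]
      [LieModule K L V] [FiniteDimensional K V],
      LieModule.IsIrreducible K L V → ¬ LieModule.IsTrivial L V →
      CE.cohomologyVanishes K L V 1 := by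
  intro W _ _ _ _ _ hW hWt
  obtain ⟨m, hm⟩ : ∃ m, Module.finrank K L = m + 1 := by
    refine Nat.exists_eq_succ_of_ne_zero fun h0 ↦ hWt ⟨fun x w ↦ ?_⟩
    have := Module.finrank_zero_iff.mp h0
    rw [Subsingleton.elim x 0, zero_lie]
  have e := Module.finBasisOfFinrankEq K L hm
  rw [hm, Nat.add_sub_cancel] at htop
  exact CE.cohomologyVanishes_one_of_dual e
    (CE.trace_ad_eq_zero e (htop _ (CE.ModularLine.isIrreducible K L)))
    (htop _ (CE.isIrreducible_dual hW) (CE.not_isTrivial_dual hWt))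
end

section
/- Let L be a 3-dimensional Lie algebra over a field K of characteristic zero. Then H^3(L, V) = 0 for every finite-dimensional non-trivial irreducible L-module V if and only if L is unimodular. -/
namespace CE

section Update

variable {L : Type}

lemma update_two_zero (a b y : L) : Function.update ![a, b] 0 y = ![y, b] := by
  ext i; fin_cases i <;> rfl

lemma update_two_one (a b y : L) : Function.update ![a, b] 1 y = ![a, y] := by
  ext i; fin_cases i <;> rfl

lemma update_three_zero (a b c y : L) : Function.update ![a, b, c] 0 y = ![y, b, c] := by
  ext i; fin_cases i <;> rfl

lemma update_three_one (a b c y : L) : Function.update ![a, b, c] 1 y = ![a, y, c] := by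
  ext i; fin_cases i <;> rfl

lemma update_three_two (a b c y : L) : Function.update ![a, b, c] 2 y = ![a, b, y] := by
  ext i; fin_cases i <;> rfl

end Update

section Multilinear

variable {K : Type} [CommRing K] {L : Type} [AddCommGroup L] [Module K L]
  {V : Type} [AddCommGroup V] [Module K V]

lemma alt_two_add_left (f : L [⋀^Fin 2]→ₗ[K] V) (a a' b : L) :
    f ![a + a', b] = f ![a, b] + f ![a', b] := by
  simpa only [update_two_zero] using f.map_update_add ![0, b] 0 a a'

lemma alt_two_add_right (f : L [⋀^Fin 2]→ₗ[K] V) (a b b' : L) :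
    f ![a, b + b'] = f ![a, b] + f ![a, b'] := by
  simpa only [update_two_one] using f.map_update_add ![a, 0] 1 b b'

lemma alt_two_smul_left (f : L [⋀^Fin 2]→ₗ[K] V) (r : K) (a b : L) :
    f ![r • a, b] = r • f ![a, b] := by
  simpa only [update_two_zero] using f.map_update_smul ![0, b] 0 r a

lemma alt_two_smul_right (f : L [⋀^Fin 2]→ₗ[K] V) (r : K) (a b : L) :
    f ![a, r • b] = r • f ![a, b] := by
  simpa only [update_two_one] using f.map_update_smul ![a, 0] 1 r b

lemma alt_two_self (f : L [⋀^Fin 2]→ₗ[K] V) (a : L) : f ![a, a] = 0 :=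
  f.map_eq_zero_of_eq _ (i := 0) (j := 1) (by simp) (by decide)

lemma alt_two_swap (f : L [⋀^Fin 2]→ₗ[K] V) (a b : L) : f ![b, a] = -f ![a, b] := by
  have h := alt_two_self f (a + b)
  rw [alt_two_add_left, alt_two_add_right, alt_two_add_right, alt_two_self, alt_two_self] at h
  rw [eq_neg_iff_add_eq_zero, add_comm]
  simpa using h

lemma alt_three_add_left (f : L [⋀^Fin 3]→ₗ[K] V) (a a' b c : L) :
    f ![a + a', b, c] = f ![a, b, c] + f ![a', b, c] := by
  simpa only [update_three_zero] using f.map_update_add ![0, b, c] 0 a a'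

lemma alt_three_add_mid (f : L [⋀^Fin 3]→ₗ[K] V) (a b b' c : L) :
    f ![a, b + b', c] = f ![a, b, c] + f ![a, b', c] := by
  simpa only [update_three_one] using f.map_update_add ![a, 0, c] 1 b b'

lemma alt_three_add_right (f : L [⋀^Fin 3]→ₗ[K] V) (a b c c' : L) :
    f ![a, b, c + c'] = f ![a, b, c] + f ![a, b, c'] := by
  simpa only [update_three_two] using f.map_update_add ![a, b, 0] 2 c c'

lemma alt_three_smul_left (f : L [⋀^Fin 3]→ₗ[K] V) (r : K) (a b c : L) :
    f ![r • a, b, c] = r • f ![a, b, c] := by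
  simpa only [update_three_zero] using f.map_update_smul ![0, b, c] 0 r a

lemma alt_three_smul_mid (f : L [⋀^Fin 3]→ₗ[K] V) (r : K) (a b c : L) :
    f ![a, r • b, c] = r • f ![a, b, c] := by
  simpa only [update_three_one] using f.map_update_smul ![a, 0, c] 1 r b

lemma alt_three_smul_right (f : L [⋀^Fin 3]→ₗ[K] V) (r : K) (a b c : L) :
    f ![a, b, r • c] = r • f ![a, b, c] := by
  simpa only [update_three_two] using f.map_update_smul ![a, b, 0] 2 r c

lemma alt_three_self_left (f : L [⋀^Fin 3]→ₗ[K] V) (a b : L) : f ![a, a, b] = 0 :=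
  f.map_eq_zero_of_eq _ (i := 0) (j := 1) (by simp) (by decide)

lemma alt_three_self_right (f : L [⋀^Fin 3]→ₗ[K] V) (a b : L) : f ![b, a, a] = 0 :=
  f.map_eq_zero_of_eq _ (i := 1) (j := 2) (by simp) (by decide)

lemma alt_three_self_outer (f : L [⋀^Fin 3]→ₗ[K] V) (a b : L) : f ![a, b, a] = 0 :=
  f.map_eq_zero_of_eq _ (i := 0) (j := 2) (by simp) (by decide)

lemma alt_three_swap_left (f : L [⋀^Fin 3]→ₗ[K] V) (a b c : L) :
    f ![b, a, c] = -f ![a, b, c] := by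
  have h := alt_three_self_left f (a + b) c
  rw [alt_three_add_left, alt_three_add_mid, alt_three_add_mid, alt_three_self_left,
    alt_three_self_left] at h
  rw [eq_neg_iff_add_eq_zero, add_comm]
  simpa using h

lemma alt_three_swap_right (f : L [⋀^Fin 3]→ₗ[K] V) (a b c : L) :
    f ![a, c, b] = -f ![a, b, c] := by
  have h := alt_three_self_right f (b + c) a
  rw [alt_three_add_mid, alt_three_add_right, alt_three_add_right, alt_three_self_right,
    alt_three_self_right] at h
  rw [eq_neg_iff_add_eq_zero, add_comm]
  simpa using h

lemma alt_two_neg_right (f : L [⋀^Fin 2]→ₗ[K] V) (a b : L) : f ![a, -b] = -f ![a, b] := by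
  simpa using alt_two_smul_right f (-1) a b

lemma alt_two_zero_left (f : L [⋀^Fin 2]→ₗ[K] V) (a : L) : f ![0, a] = 0 := by
  simpa using alt_two_smul_left f 0 0 a

lemma alt_two_zero_right (f : L [⋀^Fin 2]→ₗ[K] V) (a : L) : f ![a, 0] = 0 := by
  simpa using alt_two_smul_right f 0 a 0

lemma alt_three_neg_mid (f : L [⋀^Fin 3]→ₗ[K] V) (a b c : L) :
    f ![a, -b, c] = -f ![a, b, c] := by
  simpa using alt_three_smul_mid f (-1) a b c

lemma alt_three_neg_right (f : L [⋀^Fin 3]→ₗ[K] V) (a b c : L) :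
    f ![a, b, -c] = -f ![a, b, c] := by
  simpa using alt_three_smul_right f (-1) a b c

lemma alt_three_zero_left (f : L [⋀^Fin 3]→ₗ[K] V) (a b : L) : f ![0, a, b] = 0 := by
  simpa using alt_three_smul_left f 0 0 a b

lemma alt_three_zero_mid (f : L [⋀^Fin 3]→ₗ[K] V) (a b : L) : f ![a, 0, b] = 0 := by
  simpa using alt_three_smul_mid f 0 a 0 b

lemma alt_three_zero_right (f : L [⋀^Fin 3]→ₗ[K] V) (a b : L) : f ![a, b, 0] = 0 := by
  simpa using alt_three_smul_right f 0 a b 0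

lemma alt_three_swap_outer (f : L [⋀^Fin 3]→ₗ[K] V) (a b c : L) :
    f ![c, b, a] = -f ![a, b, c] := by
  rw [alt_three_swap_left, alt_three_swap_right, alt_three_swap_left, neg_neg]

lemma alt_three_rotate (f : L [⋀^Fin 3]→ₗ[K] V) (a b c : L) : f ![b, c, a] = f ![a, b, c] := by
  rw [alt_three_swap_right, alt_three_swap_left, neg_neg]

/-- Alternating `3`-forms on a free module of rank `3` are determined by their value on a basis. -/
lemma alt_three_ext (b : Module.Basis (Fin 3) K L) {f g : L [⋀^Fin 3]→ₗ[K] V} (h : f b = g b) :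
    f = g := by
  refine Module.Basis.ext_alternating b fun v hv ↦ ?_
  let σ : Equiv.Perm (Fin 3) := Equiv.ofBijective v (Finite.injective_iff_bijective.1 hv)
  change f (b ∘ σ) = g (b ∘ σ)
  rw [AlternatingMap.map_perm, AlternatingMap.map_perm, h]

lemma exists_two_cochain (b : Module.Basis (Fin 3) K L) (v : Fin 3 → V) :
    ∃ g : L [⋀^Fin 2]→ₗ[K] V,
      g ![b 1, b 2] = v 0 ∧ g ![b 0, b 2] = -v 1 ∧ g ![b 0, b 1] = v 2 := by
  refine ⟨∑ k, (LinearMap.toSpanSingleton K V (v k)).compAlternatingMap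
    (b.det.curryLeft (b k)), ?_⟩
  simp [Fin.sum_univ_three, Module.Basis.det_apply, Matrix.det_fin_three,
    Module.Basis.toMatrix_apply]

end Multilinear

section Differential

variable {K : Type} [CommRing K] {L : Type} [LieRing L] [LieAlgebra K L]
  {V : Type} [AddCommGroup V] [Module K V] [LieRingModule L V]

lemma d_two_apply (g : L [⋀^Fin 2]→ₗ[K] V) (x : Fin 3 → L) :
    d g x = ⁅x 0, g ![x 1, x 2]⁆ - ⁅x 1, g ![x 0, x 2]⁆ + ⁅x 2, g ![x 0, x 1]⁆
      - g ![⁅x 0, x 1⁆, x 2] + g ![⁅x 0, x 2⁆, x 1] + g ![x 0, ⁅x 1, x 2⁆] := by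
  have e0 : x ∘ (0 : Fin 3).succAbove = ![x 1, x 2] := by
    ext i; fin_cases i <;> rfl
  have e1 : x ∘ (1 : Fin 3).succAbove = ![x 0, x 2] := by
    ext i; fin_cases i <;> rfl
  have e2 : x ∘ (2 : Fin 3).succAbove = ![x 0, x 1] := by
    ext i; fin_cases i <;> rfl
  have u0 (a b y : L) (h) : Function.update ![a, b] ⟨((0 : Fin 3) : ℕ), h⟩ y = ![y, b] :=
    update_two_zero a b y
  have u1 (a b y : L) (h) : Function.update ![a, b] ⟨((1 : Fin 3) : ℕ), h⟩ y = ![a, y] :=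
    update_two_one a b y
  simp only [d, Nat.reduceAdd, Fin.sum_univ_three, e0, e1, e2, u0, u1]
  simp
  abel

lemma d_three_apply (f : L [⋀^Fin 3]→ₗ[K] V) (x : Fin 4 → L) :
    d f x = ⁅x 0, f ![x 1, x 2, x 3]⁆ - ⁅x 1, f ![x 0, x 2, x 3]⁆
      + ⁅x 2, f ![x 0, x 1, x 3]⁆ - ⁅x 3, f ![x 0, x 1, x 2]⁆
      - f ![⁅x 0, x 1⁆, x 2, x 3]
      + f ![⁅x 0, x 2⁆, x 1, x 3] + f ![x 0, ⁅x 1, x 2⁆, x 3]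
      - f ![⁅x 0, x 3⁆, x 1, x 2] - f ![x 0, ⁅x 1, x 3⁆, x 2] - f ![x 0, x 1, ⁅x 2, x 3⁆] := by
  have e0 : x ∘ (0 : Fin 4).succAbove = ![x 1, x 2, x 3] := by
    ext i; fin_cases i <;> rfl
  have e1 : x ∘ (1 : Fin 4).succAbove = ![x 0, x 2, x 3] := by
    ext i; fin_cases i <;> rfl
  have e2 : x ∘ (2 : Fin 4).succAbove = ![x 0, x 1, x 3] := by
    ext i; fin_cases i <;> rfl
  have e3 : x ∘ (3 : Fin 4).succAbove = ![x 0, x 1, x 2] := by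
    ext i; fin_cases i <;> rfl
  have u0 (a b c y : L) (h) :
      Function.update ![a, b, c] ⟨((0 : Fin 4) : ℕ), h⟩ y = ![y, b, c] :=
    update_three_zero a b c y
  have u1 (a b c y : L) (h) :
      Function.update ![a, b, c] ⟨((1 : Fin 4) : ℕ), h⟩ y = ![a, y, c] :=
    update_three_one a b c y
  have u2 (a b c y : L) (h) :
      Function.update ![a, b, c] ⟨((2 : Fin 4) : ℕ), h⟩ y = ![a, b, y] :=
    update_three_two a b c y
  have sq : (-1 : K) ^ 3 = -1 := by ring
  simp only [d, Nat.reduceAdd, Fin.sum_univ_four, e0, e1, e2, e3, u0, u1, u2]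
  simp [sq]
  abel

lemma trace_ad_eq_sum (b : Module.Basis (Fin 3) K L) (x : L) :
    LinearMap.trace K L (LieAlgebra.ad K L x) =
      b.repr ⁅x, b 0⁆ 0 + b.repr ⁅x, b 1⁆ 1 + b.repr ⁅x, b 2⁆ 2 := by
  rw [LinearMap.trace_eq_matrix_trace K b, Matrix.trace, Fin.sum_univ_three]
  simp [LinearMap.toMatrix_apply]

/-- On a basis, the differential of a `2`-cochain only involves the action on `V` twisted by the
character `x ↦ Tr (ad x)`. -/
lemma d_two_basis (b : Module.Basis (Fin 3) K L) (g : L [⋀^Fin 2]→ₗ[K] V) :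
    d g b =
      (⁅b 0, g ![b 1, b 2]⁆ - LinearMap.trace K L (LieAlgebra.ad K L (b 0)) • g ![b 1, b 2])
      - (⁅b 1, g ![b 0, b 2]⁆ - LinearMap.trace K L (LieAlgebra.ad K L (b 1)) • g ![b 0, b 2])
      + (⁅b 2, g ![b 0, b 1]⁆ - LinearMap.trace K L (LieAlgebra.ad K L (b 2)) • g ![b 0, b 1]) := by
  have expand (y : L) :
      y = b.repr y 0 • b 0 + b.repr y 1 • b 1 + b.repr y 2 • b 2 := by
    rw [← Fin.sum_univ_three (fun i ↦ b.repr y i • b i), b.sum_repr]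
  have h01 : g ![⁅b 0, b 1⁆, b 2] =
      b.repr ⁅b 0, b 1⁆ 0 • g ![b 0, b 2] + b.repr ⁅b 0, b 1⁆ 1 • g ![b 1, b 2] := by
    conv_lhs => rw [expand ⁅b 0, b 1⁆]
    simp only [alt_two_add_left, alt_two_smul_left, alt_two_self, smul_zero, add_zero]
  have h02 : g ![⁅b 0, b 2⁆, b 1] =
      b.repr ⁅b 0, b 2⁆ 0 • g ![b 0, b 1] - b.repr ⁅b 0, b 2⁆ 2 • g ![b 1, b 2] := by
    conv_lhs => rw [expand ⁅b 0, b 2⁆]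
    simp only [alt_two_add_left, alt_two_smul_left, alt_two_self, smul_zero, add_zero,
      alt_two_swap g (b 1) (b 2), smul_neg, sub_eq_add_neg]
  have h12 : g ![b 0, ⁅b 1, b 2⁆] =
      b.repr ⁅b 1, b 2⁆ 1 • g ![b 0, b 1] + b.repr ⁅b 1, b 2⁆ 2 • g ![b 0, b 2] := by
    conv_lhs => rw [expand ⁅b 1, b 2⁆]
    simp only [alt_two_add_right, alt_two_smul_right, alt_two_self, smul_zero, zero_add]
  rw [d_two_apply, h01, h02, h12, trace_ad_eq_sum b, trace_ad_eq_sum b, trace_ad_eq_sum b,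
    ← lie_skew (b 1) (b 0), ← lie_skew (b 2) (b 0), ← lie_skew (b 2) (b 1)]
  simp only [lie_self, map_neg, map_zero, Finsupp.neg_apply, Finsupp.zero_apply]
  module

variable [LieModule K L V]

/-- The differential of a `2`-cochain, as an alternating map. -/
def dTwo (g : L [⋀^Fin 2]→ₗ[K] V) : L [⋀^Fin 3]→ₗ[K] V where
  toFun := d g
  map_update_add' := by
    intro inst m i a b
    obtain rfl : inst = instDecidableEqFin 3 := Subsingleton.elim _ _
    fin_cases i <;>
      simp [d_two_apply, alt_two_add_left, alt_two_add_right] <;> abel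
  map_update_smul' := by
    intro inst m i r a
    obtain rfl : inst = instDecidableEqFin 3 := Subsingleton.elim _ _
    fin_cases i <;>
      simp [d_two_apply, alt_two_smul_left, alt_two_smul_right] <;>
      module
  map_eq_zero_of_eq' := by
    intro v i j h hij
    have key : v 0 = v 1 ∨ v 0 = v 2 ∨ v 1 = v 2 := by
      fin_cases i <;> fin_cases j <;> simp_all
    rw [d_two_apply]
    rcases key with h | h | h
    · rw [h, alt_two_swap g (v 1) ⁅v 1, v 2⁆]
      simp [alt_two_self, alt_two_zero_left]
    · rw [h, alt_two_swap g (v 2) ⁅v 2, v 1⁆, alt_two_swap g (v 1) (v 2), ← lie_skew (v 1) (v 2)]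
      simp [-lie_skew, alt_two_self, alt_two_zero_left, alt_two_neg_right]
    · simp [h, alt_two_self, alt_two_zero_right]

/-- The differential of a `3`-cochain, as an alternating map. -/
def dThree (f : L [⋀^Fin 3]→ₗ[K] V) : L [⋀^Fin 4]→ₗ[K] V where
  toFun := d f
  map_update_add' := by
    intro inst m i a b
    obtain rfl : inst = instDecidableEqFin 4 := Subsingleton.elim _ _
    fin_cases i <;>
      simp [d_three_apply, alt_three_add_left, alt_three_add_mid, alt_three_add_right] <;> abel
  map_update_smul' := by
    intro inst m i r a
    obtain rfl : inst = instDecidableEqFin 4 := Subsingleton.elim _ _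
    fin_cases i <;>
      simp [d_three_apply, alt_three_smul_left, alt_three_smul_mid, alt_three_smul_right] <;>
      module
  map_eq_zero_of_eq' := by
    intro v i j h hij
    have key : v 0 = v 1 ∨ v 0 = v 2 ∨ v 0 = v 3 ∨ v 1 = v 2 ∨ v 1 = v 3 ∨ v 2 = v 3 := by
      fin_cases i <;> fin_cases j <;> simp_all
    rw [d_three_apply]
    rcases key with h | h | h | h | h | h
    · rw [h, alt_three_swap_left f (v 1) ⁅v 1, v 2⁆, alt_three_swap_left f (v 1) ⁅v 1, v 3⁆]
      simp [alt_three_zero_left, alt_three_self_left]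
    · rw [h, alt_three_swap_left f (v 2) (v 1), ← lie_skew (v 1) (v 2),
        alt_three_swap_left f (v 2) ⁅v 2, v 1⁆, alt_three_swap_outer f (v 2) _ ⁅v 2, v 3⁆]
      simp [-lie_skew, alt_three_zero_left, alt_three_self_left, alt_three_self_outer,
        alt_three_neg_mid]
    · rw [h, alt_three_rotate f (v 3) (v 1), ← lie_skew (v 1) (v 3), ← lie_skew (v 2) (v 3),
        alt_three_rotate f (v 3) ⁅v 3, v 1⁆, alt_three_swap_outer f (v 3) _ ⁅v 3, v 2⁆]
      simp [-lie_skew, alt_three_zero_left, alt_three_self_outer, alt_three_neg_mid, alt_three_neg_right]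
    · rw [h, alt_three_swap_right f (v 0) (v 2) ⁅v 2, v 3⁆]
      simp [alt_three_zero_mid, alt_three_self_left, alt_three_self_right]
    · rw [h, alt_three_swap_right f (v 0) (v 3) (v 2), alt_three_swap_right f ⁅v 0, v 3⁆ (v 3) (v 2),
        ← lie_skew (v 2) (v 3), alt_three_swap_right f (v 0) (v 3) ⁅v 3, v 2⁆]
      simp [-lie_skew, alt_three_zero_mid, alt_three_self_right, alt_three_neg_right,
        alt_three_self_outer]
    · simp [h, alt_three_zero_right, alt_three_self_right]

end Differential

section Field

variable {K : Type} [Field K] {L : Type} [LieRing L] [LieAlgebra K L]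
  {V : Type} [AddCommGroup V] [Module K V] [LieRingModule L V] [LieModule K L V]

lemma d_three_eq_zero [FiniteDimensional K L] (hdim : Module.finrank K L = 3)
    (f : L [⋀^Fin 3]→ₗ[K] V) (x : Fin 4 → L) : d f x = 0 := by
  refine (dThree f).map_linearDependent x fun hx ↦ ?_
  have := hx.fintype_card_le_finrank
  simp [hdim] at this

lemma exists_sum_lie_eq (b : Module.Basis (Fin 3) K L) (hirr : LieModule.IsIrreducible K L V)
    (hnt : ¬ LieModule.IsTrivial L V) (w : V) :
    ∃ v : Fin 3 → V, w = ⁅b 0, v 0⁆ + ⁅b 1, v 1⁆ + ⁅b 2, v 2⁆ := by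
  have htop : ⁅(⊤ : LieIdeal K L), (⊤ : LieSubmodule K L V)⁆ = ⊤ := by
    refine (hirr.eq_bot_or_eq_top _).resolve_left fun h ↦ hnt ⟨fun x m ↦ ?_⟩
    exact (LieSubmodule.lie_eq_bot_iff _ _).1 h x trivial m trivial
  have hw : w ∈ (⁅(⊤ : LieIdeal K L), (⊤ : LieSubmodule K L V)⁆ : LieSubmodule K L V) := by
    rw [htop]; trivial
  rw [← LieSubmodule.mem_toSubmodule, LieSubmodule.lieIdeal_oper_eq_linear_span'] at hw
  induction hw using Submodule.span_induction with
  | mem w hw =>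
    obtain ⟨x, -, m, -, rfl⟩ := hw
    refine ⟨fun i ↦ b.repr x i • m, ?_⟩
    conv_lhs => rw [← b.sum_repr x, Fin.sum_univ_three]
    simp only [add_lie, smul_lie, lie_smul]
  | zero => exact ⟨0, by simp⟩
  | add y z _ _ hy hz =>
    obtain ⟨u, rfl⟩ := hy
    obtain ⟨v, rfl⟩ := hz
    exact ⟨u + v, by simp; abel⟩
  | smul r y _ hy =>
    obtain ⟨u, rfl⟩ := hy
    exact ⟨r • u, by simp⟩

lemma cohomologyVanishes_three_of_unimodular (b : Module.Basis (Fin 3) K L)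
    (huni : ∀ x : L, LinearMap.trace K L (LieAlgebra.ad K L x) = 0)
    (hirr : LieModule.IsIrreducible K L V) (hnt : ¬ LieModule.IsTrivial L V) :
    cohomologyVanishes K L V 3 := by
  intro f _
  obtain ⟨v, hv⟩ := exists_sum_lie_eq b hirr hnt (f b)
  obtain ⟨g, h12, h02, h01⟩ := exists_two_cochain b v
  have hfg : f = dTwo g := alt_three_ext b <| by
    change f b = d g b
    simp [d_two_basis, huni, h12, h02, h01, hv]
  exact ⟨g, fun x ↦ DFunLike.congr_fun hfg x⟩

/-- If `L` acts on `V` through the scalars `Tr (ad x)`, then `H³(L, V) ≠ 0` unless `V = 0`. -/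
lemma not_cohomologyVanishes_three [Nontrivial V] [FiniteDimensional K L]
    (hdim : Module.finrank K L = 3)
    (hact : ∀ (x : L) (v : V), ⁅x, v⁆ = LinearMap.trace K L (LieAlgebra.ad K L x) • v) :
    ¬ cohomologyVanishes K L V 3 := by
  intro h
  let b := Module.finBasisOfFinrankEq K L hdim
  obtain ⟨v, hv⟩ := exists_ne (0 : V)
  obtain ⟨g, hg⟩ := h ((LinearMap.toSpanSingleton K V v).compAlternatingMap b.det)
    (d_three_eq_zero hdim _)
  have := hg b
  rw [d_two_basis] at this
  simp [hact, b.det_self] at this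
  exact hv this

variable (K L) in
/-- The one-dimensional module on which `x : L` acts as the scalar `Tr (ad x)`. -/
noncomputable abbrev traceRingModule : LieRingModule L K where
  bracket x a := LinearMap.trace K L (LieAlgebra.ad K L x) * a
  add_lie x y m := by simp [add_mul]
  lie_add x m n := mul_add _ _ _
  leibniz_lie x y m := by
    simp only [LieHom.map_lie, LinearMap.trace_lie]
    ring

variable (K L) in
lemma traceRingModule_lieModule : letI := traceRingModule K L; LieModule K L K :=
  letI := traceRingModule K L
  { smul_lie := fun t x m ↦ by
      change LinearMap.trace K L (LieAlgebra.ad K L (t • x)) * m =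
        t * (LinearMap.trace K L (LieAlgebra.ad K L x) * m)
      simp [mul_assoc]
    lie_smul := fun t x m ↦ mul_left_comm _ _ _ }

end Field

end CE


/-- For a `3`-dimensional Lie algebra `L` over a field of
characteristic zero, `H³(L, V) = 0` for every finite-dimensional non-trivial
irreducible `L`-module `V` if and only if `L` is unimodular. -/
theorem h3_vanishes_iff_unimodular_of_dim_three
    (K : Type) [Field K] [CharZero K]
    (L : Type) [LieRing L] [LieAlgebra K L] [FiniteDimensional K L]
    (hdim : Module.finrank K L = 3) :
    (∀ (V : Type) [AddCommGroup V] [Module K V] [LieRingModule L V]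
      [LieModule K L V] [FiniteDimensional K V],
      LieModule.IsIrreducible K L V → ¬ LieModule.IsTrivial L V →
      CE.cohomologyVanishes K L V 3) ↔
    (∀ x : L, LinearMap.trace K L (LieAlgebra.ad K L x) = 0) := by
  refine ⟨fun h ↦ ?_, fun huni V _ _ _ _ _ hirr hnt ↦
    CE.cohomologyVanishes_three_of_unimodular (Module.finBasisOfFinrankEq K L hdim) huni hirr hnt⟩
  by_contra! hx
  obtain ⟨x, hx⟩ := hx
  let _ := CE.traceRingModule K L
  have := CE.traceRingModule_lieModule K L
  refine CE.not_cohomologyVanishes_three (V := K) hdim (fun _ _ ↦ rfl) (h K ?_ fun ht ↦ ?_)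
  · refine LieModule.IsIrreducible.mk fun N hN ↦ ?_
    rw [← LieSubmodule.toSubmodule_eq_top]
    exact (eq_bot_or_eq_top (N : Submodule K K)).resolve_left
      (by rwa [LieSubmodule.toSubmodule_eq_bot])
  · exact hx ((mul_one _).symm.trans (ht.trivial x (1 : K)))
end

section
/- Let L be a finite-dimensional Lie algebra over a field K of characteristic zero such that H^1(L, V) = 0 for every finite-dimensional non-trivial irreducible L-module V, and let I be an ideal of L. Then the quotient Lie algebra L/I also satisfies this condition: H^1(L/I, W) = 0 for every finite-dimensional non-trivial irreducible L/I-module W. -/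
namespace CE

variable {K : Type} [CommRing K] {L L' : Type} [LieRing L] [LieAlgebra K L]
  [LieRing L'] [LieAlgebra K L']
  {V : Type} [AddCommGroup V] [Module K V] [LieRingModule L V] [LieRingModule L' V]

/-- The Chevalley–Eilenberg differential commutes with pulling cochains back along a
homomorphism of Lie algebras. -/
theorem d_compLinearMap (π : L →ₗ⁅K⁆ L') (hπ : ∀ (x : L) (v : V), ⁅π x, v⁆ = ⁅x, v⁆)
    {n : ℕ} (f : L' [⋀^Fin n]→ₗ[K] V) (x : Fin (n + 1) → L) :
    d (f.compLinearMap (π : L →ₗ[K] L')) x = d f (π ∘ x) := by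
  unfold d
  congr 1
  · refine Finset.sum_congr rfl fun i _ => ?_
    rw [Function.comp_apply, hπ]
    rfl
  · refine Finset.sum_congr rfl fun j _ => Finset.sum_congr rfl fun i _ => ?_
    split_ifs with h
    · rw [AlternatingMap.compLinearMap_apply]
      congr 2
      exact (Function.comp_update π _ _ _).trans (by rw [LieHom.map_lie]; rfl)
    · rfl

/-- Vanishing of `H¹` descends along a surjective homomorphism of Lie algebras. -/
theorem cohomologyVanishes_one_of_surjective (π : L →ₗ⁅K⁆ L') (hsurj : Function.Surjective π)
    (hπ : ∀ (x : L) (v : V), ⁅π x, v⁆ = ⁅x, v⁆) (h : cohomologyVanishes K L V 1) :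
    cohomologyVanishes K L' V 1 := by
  intro f hf
  obtain ⟨g, hg⟩ := h (f.compLinearMap (π : L →ₗ[K] L')) fun x => by
    rw [d_compLinearMap π hπ, hf]
  refine ⟨AlternatingMap.constOfIsEmpty K L' (Fin 0) (g 0), fun y => ?_⟩
  obtain ⟨x, rfl⟩ := hsurj.comp_left y
  have hpull : g = (AlternatingMap.constOfIsEmpty K L' (Fin 0) (g 0)).compLinearMap
      (π : L →ₗ[K] L') := by
    ext z
    exact congrArg g (Subsingleton.elim z 0)
  rw [← d_compLinearMap π hπ, ← hpull, ← hg]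
  rfl

end CE

/-- Irreducibility of a module is inherited by its restriction along a surjective homomorphism
of Lie algebras. -/
theorem LieModule.IsIrreducible.of_surjective {K L L' V : Type} [CommRing K]
    [LieRing L] [LieAlgebra K L] [LieRing L'] [LieAlgebra K L']
    [AddCommGroup V] [Module K V] [LieRingModule L V] [LieRingModule L' V]
    (π : L →ₗ⁅K⁆ L') (hsurj : Function.Surjective π)
    (hπ : ∀ (x : L) (v : V), ⁅π x, v⁆ = ⁅x, v⁆) (hV : LieModule.IsIrreducible K L' V) :
    LieModule.IsIrreducible K L V := by
  have : Nontrivial V := (LieSubmodule.nontrivial_iff K L' V).mp inferInstance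
  refine .mk fun N hN => ?_
  let N' : LieSubmodule K L' V :=
    { N.toSubmodule with
      lie_mem := fun {y v} hv => by
        obtain ⟨x, rfl⟩ := hsurj y
        rw [hπ]
        exact N.lie_mem hv }
  have hN' : N'.toSubmodule = N.toSubmodule := rfl
  rcases eq_bot_or_eq_top N' with h | h
  · refine absurd ?_ hN
    rw [← LieSubmodule.toSubmodule_eq_bot, ← hN', h, LieSubmodule.bot_toSubmodule]
  · rw [← LieSubmodule.toSubmodule_eq_top, ← hN', h, LieSubmodule.top_toSubmodule]

/-- The condition "`H¹(·, V) = 0` for every finite-dimensional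
non-trivial irreducible module `V`" passes to quotients: if `L` satisfies it and `I` is
an ideal of `L`, then `L/I` satisfies it as well. -/
theorem h1_condition_of_quotient
    (K : Type) [Field K] [CharZero K]
    (L : Type) [LieRing L] [LieAlgebra K L] [FiniteDimensional K L]
    (h1 : ∀ (V : Type) [AddCommGroup V] [Module K V] [LieRingModule L V]
      [LieModule K L V] [FiniteDimensional K V],
      LieModule.IsIrreducible K L V → ¬ LieModule.IsTrivial L V →
      CE.cohomologyVanishes K L V 1)
    (I : LieIdeal K L) :
    ∀ (W : Type) [AddCommGroup W] [Module K W] [LieRingModule (L ⧸ I) W]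
      [LieModule K (L ⧸ I) W] [FiniteDimensional K W],
      LieModule.IsIrreducible K (L ⧸ I) W → ¬ LieModule.IsTrivial (L ⧸ I) W →
      CE.cohomologyVanishes K (L ⧸ I) W 1 := by
  intro W _ _ _ _ _ hirr hnontriv
  let π : L →ₗ⁅K⁆ L ⧸ I :=
    { (LieSubmodule.Quotient.mk' I : L →ₗ[K] L ⧸ I) with map_lie' := rfl }
  have hsurj : Function.Surjective π := LieSubmodule.Quotient.surjective_mk' I
  let : LieRingModule L W := LieRingModule.compLieHom W π
  have : LieModule K L W := LieModule.compLieHom W π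
  have hπ (x : L) (w : W) : ⁅π x, w⁆ = ⁅x, w⁆ := rfl
  refine CE.cohomologyVanishes_one_of_surjective π hsurj hπ
    (h1 W (hirr.of_surjective π hsurj hπ) fun htriv => hnontriv ⟨fun y w => ?_⟩)
  obtain ⟨x, rfl⟩ := hsurj y
  rw [hπ, htriv.trivial]
end
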